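/- Subject reduction for β in ⊢2: if M : ⟨Γ ⊢2 U⟩ is derivable and M ▷β* N, then N : ⟨Γ ⊢2 U⟩ is derivable. -/

import Mathlib

/-! Common development: the indexed λI-calculus (the λI^ℕ-calculus), types with
expansion variables, the realisability semantics, and the typing systems ⊢1 and ⊢2. -/

/-- The set of variables 𝓥, split as the disjoint union of two denumerably
infinite sets 𝓥₁ (`Sum.inl`) and 𝓥₂ (`Sum.inr`). -/
abbrev Vr : Type := ℕ ⊕ ℕ

/-- Raw terms of the λI^ℕ-calculus: every variable occurrence carries a degree. -/
inductive Trm : Type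
  | var : Vr → ℕ → Trm
  | app : Trm → Trm → Trm
  | lam : Vr → ℕ → Trm → Trm
  deriving DecidableEq

namespace Trm

/-- Free indexed variables `FV M`. -/
def FV : Trm → Set (Vr × ℕ)
  | var x n => {(x, n)}
  | app M N => FV M ∪ FV N
  | lam x n M => FV M \ {(x, n)}

/-- Names that are λ-bound somewhere in the term. -/
def BV : Trm → Set Vr
  | var _ _ => ∅
  | app M N => BV M ∪ BV N
  | lam x _ M => insert x (BV M)

/-- Degree `d(M)` of a term. -/
def deg : Trm → ℕ
  | var _ n => n
  | app M N => min (deg M) (deg N)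
  | lam _ _ M => deg M

/-- Joinability `M ◇ N`: any variable free in both occurs with the same degree. -/
def Joinable (M N : Trm) : Prop :=
  ∀ x m n, (x, m) ∈ FV M → (x, n) ∈ FV N → m = n

/-- Membership in the set 𝓜 of terms (λI-condition and joinability at applications). -/
inductive InM : Trm → Prop
  | var (x : Vr) (n : ℕ) : InM (Trm.var x n)
  | app {M N : Trm} : InM M → InM N → Joinable M N → InM (Trm.app M N)
  | lam {M : Trm} {x : Vr} {n : ℕ} : InM M → (x, n) ∈ FV M → InM (Trm.lam x n M)

/-- The good terms 𝕄: the degree of a function is never larger than that of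
its argument. -/
inductive Good : Trm → Prop
  | var (x : Vr) (n : ℕ) : Good (Trm.var x n)
  | app {M N : Trm} : Good M → Good N → Joinable M N → deg M ≤ deg N →
      Good (Trm.app M N)
  | lam {M : Trm} {x : Vr} {n : ℕ} : Good M → (x, n) ∈ FV M → Good (Trm.lam x n M)

/-- Substitution of `N` for `x^n` (capture is excluded by side conditions on its
uses, following the Barendregt convention). -/
def subst (x : Vr) (n : ℕ) (N : Trm) : Trm → Trm
  | var y m => if y = x ∧ m = n then N else var y m
  | app P Q => app (subst x n N P) (subst x n N Q)
  | lam y m P => if y = x ∧ m = n then lam y m P else lam y m (subst x n N P)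

/-- `M⁺`: raise every degree index by one. -/
def lift : Trm → Trm
  | var x n => var x (n + 1)
  | app M N => app (lift M) (lift N)
  | lam x n M => lam x (n + 1) (lift M)

/-- One-step β-reduction `▷β`: the least compatible relation closed under the
rule `(λx^n.M)N ▷β M[x^n := N]` when `d(N) = n` (the λI-condition `x^n ∈ FV M`
and the absence of capture come from working with terms of 𝓜 modulo α under
the Barendregt convention). -/
inductive Beta : Trm → Trm → Prop
  | redex {x : Vr} {n : ℕ} {M N : Trm} :
      (x, n) ∈ FV M → deg N = n →
      (∀ y m, (y, m) ∈ FV N → y ∉ BV M) →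
      Beta (Trm.app (Trm.lam x n M) N) (subst x n N M)
  | lam {M N : Trm} {x : Vr} {n : ℕ} :
      Beta M N → (x, n) ∈ FV M → (x, n) ∈ FV N →
      Beta (Trm.lam x n M) (Trm.lam x n N)
  | appL {M N P : Trm} :
      Beta M N → Joinable M P → Joinable N P →
      Beta (Trm.app M P) (Trm.app N P)
  | appR {M N P : Trm} :
      Beta M N → Joinable P M → Joinable P N →
      Beta (Trm.app P M) (Trm.app P N)

/-- `▷β*`: the reflexive transitive closure of `▷β`. -/
def Betas : Trm → Trm → Prop := Relation.ReflTransGen Beta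

end Trm

/-- `𝕄ⁿ`: the good terms of degree `n`. -/
def Mdeg (n : ℕ) : Set Trm := {M | Trm.Good M ∧ Trm.deg M = n}

/-- A set of terms is saturated iff it is closed under β-expansion. -/
def Saturated (X : Set Trm) : Prop := ∀ M N, Trm.Betas M N → N ∈ X → M ∈ X

/-- `X ⤳ Y`. -/
def ArrSet (X Y : Set Trm) : Set Trm :=
  {M | ∀ N ∈ X, Trm.Joinable M N → Trm.app M N ∈ Y}

/-- `𝓝ₓⁿ = {x^n N₁ … N_k ∈ 𝕄 ∣ k ≥ 0}` for `x ∈ 𝓥₁`. -/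
def NSet (x n : ℕ) : Set Trm :=
  {M | Trm.Good M ∧ ∃ l : List Trm, M = l.foldl Trm.app (Trm.var (Sum.inl x) n)}

/-- Types over the denumerable set ℕ of atomic types and a set `E` of expansion
variables. -/
inductive Ty (E : Type) : Type
  | atom : ℕ → Ty E
  | arr : Ty E → Ty E → Ty E
  | inter : Ty E → Ty E → Ty E
  | exp : E → Ty E → Ty E

namespace Ty

variable {E : Type}

/-- Degree `d(U)` of a type. -/
def deg : Ty E → ℕ
  | atom _ => 0
  | arr U T => min (deg U) (deg T)
  | inter U V => min (deg U) (deg V)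
  | exp _ U => deg U + 1

/-- Good types. -/
inductive GoodTy : Ty E → Prop
  | atom (a : ℕ) : GoodTy (Ty.atom a)
  | exp {U : Ty E} (e : E) : GoodTy U → GoodTy (Ty.exp e U)
  | arr {U T : Ty E} : GoodTy U → GoodTy T → deg T ≤ deg U → GoodTy (Ty.arr U T)
  | inter {U V : Ty E} : GoodTy U → GoodTy V → deg U = deg V → GoodTy (Ty.inter U V)

mutual
  /-- The restricted types 𝕋 (no arrow on the left of ⊓ or of an expansion). -/
  inductive IsT : Ty E → Prop
    | atom (a : ℕ) : IsT (Ty.atom a)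
    | arr {U T : Ty E} : IsU U → IsT T → IsT (Ty.arr U T)
  /-- The restricted types 𝕌. -/
  inductive IsU : Ty E → Prop
    | ofT {T : Ty E} : IsT T → IsU T
    | inter {U V : Ty E} : IsU U → IsU V → IsU (Ty.inter U V)
    | exp {U : Ty E} (e : E) : IsU U → IsU (Ty.exp e U)
end

/-- Equality of types induced by the quotient (⊓ commutative, associative,
idempotent, and `e(U₁ ⊓ U₂) = eU₁ ⊓ eU₂`), as a congruence. -/
inductive TEq : Ty E → Ty E → Prop
  | refl (U : Ty E) : TEq U U
  | symm {U V : Ty E} : TEq U V → TEq V U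
  | trans {U V W : Ty E} : TEq U V → TEq V W → TEq U W
  | comm (U V : Ty E) : TEq (Ty.inter U V) (Ty.inter V U)
  | assoc (U V W : Ty E) : TEq (Ty.inter (Ty.inter U V) W) (Ty.inter U (Ty.inter V W))
  | idem (U : Ty E) : TEq (Ty.inter U U) U
  | dist (e : E) (U V : Ty E) :
      TEq (Ty.exp e (Ty.inter U V)) (Ty.inter (Ty.exp e U) (Ty.exp e V))
  | arrCongr {U U' T T' : Ty E} : TEq U U' → TEq T T' → TEq (Ty.arr U T) (Ty.arr U' T')
  | interCongr {U U' V V' : Ty E} : TEq U U' → TEq V V' →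
      TEq (Ty.inter U V) (Ty.inter U' V')
  | expCongr (e : E) {U U' : Ty E} : TEq U U' → TEq (Ty.exp e U) (Ty.exp e U')

/-- The degree-decreasing operation `U⁻` (meaningful when `d(U) > 0`). -/
def tmin : Ty E → Ty E
  | exp _ U => U
  | inter U V => inter (tmin U) (tmin V)
  | atom a => atom a
  | arr U T => arr U T

/-- The subtyping relation ⊑ on 𝕌.  It contains the quotient equality `TEq`,
which makes it reflexive on equivalence classes of types. -/
inductive TSub : Ty E → Ty E → Prop
  | ofEq {U V : Ty E} : TEq U V → TSub U V
  | trans {U V W : Ty E} : TSub U V → TSub V W → TSub U W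
  | interElim {U₁ U₂ : Ty E} : GoodTy U₂ → deg U₁ = deg U₂ →
      TSub (Ty.inter U₁ U₂) U₁
  | interCongr {U₁ U₂ V₁ V₂ : Ty E} : TSub U₁ V₁ → TSub U₂ V₂ →
      TSub (Ty.inter U₁ U₂) (Ty.inter V₁ V₂)
  | arr {U₁ U₂ T₁ T₂ : Ty E} : TSub U₂ U₁ → TSub T₁ T₂ →
      TSub (Ty.arr U₁ T₁) (Ty.arr U₂ T₂)
  | expCongr (e : E) {U V : Ty E} : TSub U V → TSub (Ty.exp e U) (Ty.exp e V)

end Ty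

/-- Type environments: finite maps from indexed variables to types. -/
abbrev Env (E : Type) : Type := Vr × ℕ → Option (Ty E)

namespace Env

variable {E : Type}

/-- The empty environment `()`. -/
def empty : Env E := fun _ => none

def dom (Γ : Env E) : Set (Vr × ℕ) := {p | Γ p ≠ none}

/-- The singleton environment `(x^n : U)`. -/
def single (p : Vr × ℕ) (U : Ty E) : Env E := fun q => if q = p then some U else none

/-- The extension `Γ, (x^n : U)`. -/
def update (Γ : Env E) (p : Vr × ℕ) (U : Ty E) : Env E :=
  fun q => if q = p then some U else Γ q

/-- Joinability `Γ₁ ◇ Γ₂` of environments. -/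
def Joinable (Γ₁ Γ₂ : Env E) : Prop :=
  ∀ x m n, (x, m) ∈ dom Γ₁ → (x, n) ∈ dom Γ₂ → m = n

/-- `Γ₁ ⊓ Γ₂`. -/
def inter (Γ₁ Γ₂ : Env E) : Env E := fun p =>
  match Γ₁ p, Γ₂ p with
  | some U, some V => some (Ty.inter U V)
  | some U, none => some U
  | none, o => o

/-- `eΓ`: apply `e` to every type of `Γ` and raise every variable index by one. -/
def eexp (e : E) (Γ : Env E) : Env E := fun p =>
  match p with
  | (_, 0) => none
  | (x, n + 1) => (Γ (x, n)).map (Ty.exp e)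

/-- A good environment. -/
def Good (Γ : Env E) : Prop := ∀ p U, Γ p = some U → Ty.GoodTy U

/-- Environments equal up to the quotient equality on types. -/
def EqT (Γ Γ' : Env E) : Prop :=
  (∀ p, Γ p = none ↔ Γ' p = none) ∧
  ∀ p U U', Γ p = some U → Γ' p = some U' → Ty.TEq U U'

/-- Pointwise subtyping of environments (with the same domain). -/
def LE (Γ Γ' : Env E) : Prop :=
  (∀ p, Γ p = none ↔ Γ' p = none) ∧
  ∀ p U U', Γ p = some U → Γ' p = some U' → Ty.TSub U U'

end Env

/-- The typing system ⊢1 (types range over the full set 𝓣). -/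
inductive Der1 {E : Type} : Trm → Env E → Ty E → Prop
  | ax (x : Vr) (n : ℕ) {T : Ty E} : Ty.GoodTy T → Ty.deg T = n →
      Der1 (Trm.var x n) (Env.single (x, n) T) T
  | arrI {Γ : Env E} {x : Vr} {n : ℕ} {M : Trm} {U T : Ty E} :
      Γ (x, n) = none → Der1 M (Env.update Γ (x, n) U) T →
      Der1 (Trm.lam x n M) Γ (Ty.arr U T)
  | arrE {Γ₁ Γ₂ : Env E} {M₁ M₂ : Trm} {U T : Ty E} :
      Der1 M₁ Γ₁ (Ty.arr U T) → Der1 M₂ Γ₂ U → Env.Joinable Γ₁ Γ₂ →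
      Der1 (Trm.app M₁ M₂) (Env.inter Γ₁ Γ₂) T
  | inter {Γ₁ Γ₂ : Env E} {M : Trm} {U₁ U₂ : Ty E} :
      Der1 M Γ₁ U₁ → Der1 M Γ₂ U₂ →
      Der1 M (Env.inter Γ₁ Γ₂) (Ty.inter U₁ U₂)
  | exp (e : E) {Γ : Env E} {M : Trm} {U : Ty E} :
      Der1 M Γ U → Der1 (Trm.lift M) (Env.eexp e Γ) (Ty.exp e U)
  | eq {Γ Γ' : Env E} {M : Trm} {U U' : Ty E} :
      Der1 M Γ U → Env.EqT Γ Γ' → Ty.TEq U U' → Der1 M Γ' U'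

/-- The typing system ⊢2 (types range over 𝕌, with `T` ranging over 𝕋),
with the subsumption rule for ⊑. -/
inductive Der2 {E : Type} : Trm → Env E → Ty E → Prop
  | ax (x : Vr) {T : Ty E} : Ty.IsT T → Ty.GoodTy T →
      Der2 (Trm.var x 0) (Env.single (x, 0) T) T
  | arrI {Γ : Env E} {x : Vr} {n : ℕ} {M : Trm} {U T : Ty E} :
      Ty.IsU U → Ty.IsT T →
      Γ (x, n) = none → Der2 M (Env.update Γ (x, n) U) T →
      Der2 (Trm.lam x n M) Γ (Ty.arr U T)
  | arrE {Γ₁ Γ₂ : Env E} {M₁ M₂ : Trm} {U T : Ty E} :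
      Ty.IsU U → Ty.IsT T →
      Der2 M₁ Γ₁ (Ty.arr U T) → Der2 M₂ Γ₂ U → Env.Joinable Γ₁ Γ₂ →
      Der2 (Trm.app M₁ M₂) (Env.inter Γ₁ Γ₂) T
  | inter {Γ₁ Γ₂ : Env E} {M : Trm} {U₁ U₂ : Ty E} :
      Der2 M Γ₁ U₁ → Der2 M Γ₂ U₂ →
      Der2 M (Env.inter Γ₁ Γ₂) (Ty.inter U₁ U₂)
  | exp (e : E) {Γ : Env E} {M : Trm} {U : Ty E} :
      Der2 M Γ U → Der2 (Trm.lift M) (Env.eexp e Γ) (Ty.exp e U)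
  | sub {Γ Γ' : Env E} {M : Trm} {U U' : Ty E} :
      Der2 M Γ U → Ty.TSub U U' → Env.LE Γ' Γ → Der2 M Γ' U'

/-- An interpretation `𝓘 : 𝓐 → 𝓟(𝓜⁰)`: each `𝓘(a)` is saturated and
`𝓝ₓ⁰ ⊆ 𝓘(a) ⊆ 𝕄⁰` for every `x ∈ 𝓥₁`. -/
def IsInterp (I : ℕ → Set Trm) : Prop :=
  ∀ a : ℕ, Saturated (I a) ∧ (∀ x : ℕ, NSet x 0 ⊆ I a) ∧ I a ⊆ Mdeg 0

/-- The extension of an interpretation to all types: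
`𝓘(eU) = 𝓘(U)⁺`, `𝓘(U ⊓ V) = 𝓘(U) ∩ 𝓘(V)`, `𝓘(U → T) = 𝓘(U) ⤳ 𝓘(T)`. -/
def IntExt {E : Type} (I : ℕ → Set Trm) : Ty E → Set Trm
  | Ty.atom a => I a
  | Ty.arr U T => ArrSet (IntExt I U) (IntExt I T)
  | Ty.inter U V => IntExt I U ∩ IntExt I V
  | Ty.exp _ U => Trm.lift '' IntExt I U

/-- The meaning `[U]` of a type: the closed terms belonging to `𝓘(U)` for
every interpretation `𝓘`. -/
def Mean {E : Type} (U : Ty E) : Set Trm :=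
  {M | Trm.InM M ∧ Trm.FV M = ∅ ∧ ∀ I : ℕ → Set Trm, IsInterp I → M ∈ IntExt I U}

/-- Simultaneous substitution along a finite assignment `σ`. -/
def msubst (σ : Vr × ℕ → Option Trm) : Trm → Trm
  | Trm.var x n => (σ (x, n)).getD (Trm.var x n)
  | Trm.app M N => Trm.app (msubst σ M) (msubst σ N)
  | Trm.lam x n M => Trm.lam x n (msubst (fun p => if p = (x, n) then none else σ p) M)

/-- The simultaneous substitution `M[(xⱼ^{nⱼ} := Nⱼ)ⱼ]` is defined: the set
`{M} ∪ {Nⱼ ∣ j}` is pairwise joinable and (Barendregt convention) no capture occurs. -/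
def SubstDefined (σ : Vr × ℕ → Option Trm) (M : Trm) : Prop :=
  (∀ p N, σ p = some N → Trm.Joinable M N) ∧
  (∀ p q N N', σ p = some N → σ q = some N' → Trm.Joinable N N') ∧
  (∀ p N y m, σ p = some N → (y, m) ∈ Trm.FV N → y ∉ Trm.BV M)

namespace Trm

theorem lift_injective : Function.Injective lift := by
  intro M
  induction M with
  | var x n => intro N h; cases N <;> simp_all [lift]
  | app P Q ihP ihQ =>
    intro N h
    cases N <;> simp only [lift, app.injEq, reduceCtorEq] at h
    rw [ihP h.1, ihQ h.2]
  | lam x n P ih =>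
    intro N h
    cases N <;> simp only [lift, lam.injEq, reduceCtorEq] at h
    rw [h.1, ih h.2.2, Nat.succ_injective h.2.1]

theorem mem_FV_lift {M : Trm} {x : Vr} {n : ℕ} : (x, n + 1) ∈ FV (lift M) ↔ (x, n) ∈ FV M := by
  induction M <;> simp_all [lift, FV]

theorem not_mem_FV_lift_zero {M : Trm} {x : Vr} : (x, 0) ∉ FV (lift M) := by
  induction M <;> simp_all [lift, FV]

theorem BV_lift (M : Trm) : BV (lift M) = BV M := by
  induction M <;> simp_all [lift, BV]

theorem deg_lift (M : Trm) : deg (lift M) = deg M + 1 := by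
  induction M <;> simp_all [lift, deg]

theorem subst_lift (x : Vr) (n : ℕ) (N M : Trm) :
    subst x (n + 1) (lift N) (lift M) = lift (subst x n N M) := by
  induction M with
  | var y m => simp only [lift, subst, Nat.add_right_cancel_iff]; split <;> simp [lift]
  | app P Q ihP ihQ => simp [lift, subst, ihP, ihQ]
  | lam y m P ih => simp only [lift, subst, Nat.add_right_cancel_iff]; split <;> simp [lift, ih]

theorem subst_eq_self {x : Vr} {n : ℕ} {N M : Trm} (h : (x, n) ∉ FV M) : subst x n N M = M := by
  induction M with
  | var y m =>
    simp only [FV, Set.mem_singleton_iff, Prod.mk.injEq] at h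
    simp only [subst]
    grind
  | app P Q ihP ihQ =>
    simp only [FV, Set.mem_union, not_or] at h
    simp [subst, ihP h.1, ihQ h.2]
  | lam y m P ih =>
    simp only [FV, Set.mem_sdiff, Set.mem_singleton_iff, Prod.mk.injEq] at h
    simp only [subst]
    split
    · rfl
    · rw [ih]; grind

theorem Joinable.of_lift {M N : Trm} (h : Joinable (lift M) (lift N)) : Joinable M N := by
  intro x m n hm hn
  exact Nat.succ_injective (h x _ _ (mem_FV_lift.2 hm) (mem_FV_lift.2 hn))

theorem Beta.of_lift {M N : Trm} (h : Beta (lift M) N) : ∃ N', N = lift N' ∧ Beta M N' := by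
  generalize hL : lift M = L at h
  induction h generalizing M with
  | @redex x n P Q hx hd hc =>
    cases M with
    | var => simp [lift] at hL
    | lam => simp [lift] at hL
    | app M₁ M₂ =>
      cases M₁ <;> simp only [lift, app.injEq, lam.injEq, reduceCtorEq, false_and] at hL
      obtain ⟨⟨rfl, rfl, rfl⟩, rfl⟩ := hL
      refine ⟨_, subst_lift _ _ _ _, .redex (mem_FV_lift.1 hx) ?_ ?_⟩
      · rw [deg_lift] at hd; omega
      · intro y m hy
        rw [← BV_lift]
        exact hc y (m + 1) (mem_FV_lift.2 hy)
  | lam _ hP hQ ih =>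
    cases M <;> simp only [lift, lam.injEq, reduceCtorEq] at hL
    obtain ⟨rfl, rfl, rfl⟩ := hL
    obtain ⟨N', rfl, hb⟩ := ih rfl
    exact ⟨_, rfl, .lam hb (mem_FV_lift.1 hP) (mem_FV_lift.1 hQ)⟩
  | appL _ h₁ h₂ ih =>
    cases M <;> simp only [lift, app.injEq, reduceCtorEq] at hL
    obtain ⟨rfl, rfl⟩ := hL
    obtain ⟨N', rfl, hb⟩ := ih rfl
    exact ⟨.app N' _, rfl, .appL hb h₁.of_lift h₂.of_lift⟩
  | appR _ h₁ h₂ ih =>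
    cases M <;> simp only [lift, app.injEq, reduceCtorEq] at hL
    obtain ⟨rfl, rfl⟩ := hL
    obtain ⟨N', rfl, hb⟩ := ih rfl
    exact ⟨.app _ N', rfl, .appR hb h₁.of_lift h₂.of_lift⟩

end Trm

namespace Ty

variable {E : Type}

theorem goodTy_exp_iff {e : E} {U : Ty E} : GoodTy (exp e U) ↔ GoodTy U :=
  ⟨fun h => by cases h; assumption, .exp e⟩

theorem goodTy_arr_iff {U T : Ty E} :
    GoodTy (arr U T) ↔ GoodTy U ∧ GoodTy T ∧ deg T ≤ deg U :=
  ⟨fun h => by cases h; exact ⟨‹_›, ‹_›, ‹_›⟩, fun h => .arr h.1 h.2.1 h.2.2⟩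

theorem goodTy_inter_iff {U V : Ty E} :
    GoodTy (inter U V) ↔ GoodTy U ∧ GoodTy V ∧ deg U = deg V :=
  ⟨fun h => by cases h; exact ⟨‹_›, ‹_›, ‹_›⟩, fun h => .inter h.1 h.2.1 h.2.2⟩

theorem IsT.deg_eq_zero {T : Ty E} : IsT T → deg T = 0
  | .atom _ => rfl
  | .arr _ h => by simp [deg, h.deg_eq_zero]

theorem TEq.deg_eq_and_good_iff {U V : Ty E} (h : TEq U V) :
    deg U = deg V ∧ (GoodTy U ↔ GoodTy V) := by
  induction h <;> grind [deg, goodTy_arr_iff, goodTy_exp_iff, goodTy_inter_iff]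

theorem TSub.deg_eq_and_good_iff {U V : Ty E} (h : TSub U V) :
    deg U = deg V ∧ (GoodTy U ↔ GoodTy V) := by
  induction h with
  | ofEq h => exact h.deg_eq_and_good_iff
  | _ => grind [deg, goodTy_arr_iff, goodTy_exp_iff, goodTy_inter_iff]

theorem TSub.inter_left {U V : Ty E} (h : GoodTy (inter U V)) : TSub (inter U V) U :=
  have h := goodTy_inter_iff.1 h
  .interElim h.2.1 h.2.2

theorem TSub.inter_right {U V : Ty E} (h : GoodTy (inter U V)) : TSub (inter U V) V :=
  have h := goodTy_inter_iff.1 h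
  .trans (.ofEq (.comm _ _)) (.interElim h.1 h.2.2.symm)

end Ty

namespace Env

variable {E : Type}

/-- The environment `Γ` with the declaration of `p` removed. -/
def erase (Γ : Env E) (p : Vr × ℕ) : Env E := fun q => if q = p then none else Γ q

theorem EqT.refl (Γ : Env E) : EqT Γ Γ :=
  ⟨fun _ => .rfl, fun _ U U' h h' => by
    obtain rfl : U = U' := by simpa [h] using h'
    exact .refl U⟩

theorem EqT.symm {Γ Γ' : Env E} (h : EqT Γ Γ') : EqT Γ' Γ :=
  ⟨fun p => (h.1 p).symm, fun p U U' hU hU' => (h.2 p U' U hU' hU).symm⟩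

theorem EqT.trans {Γ₁ Γ₂ Γ₃ : Env E} (h : EqT Γ₁ Γ₂) (h' : EqT Γ₂ Γ₃) : EqT Γ₁ Γ₃ := by
  refine ⟨fun p => (h.1 p).trans (h'.1 p), fun p U W hU hW => ?_⟩
  cases hV : Γ₂ p with
  | none => simp [(h.1 p).2 hV] at hU
  | some V => exact (h.2 p U V hU hV).trans (h'.2 p V W hV hW)

theorem EqT.le {Γ Γ' : Env E} (h : EqT Γ Γ') : LE Γ Γ' :=
  ⟨h.1, fun p U U' hU hU' => .ofEq (h.2 p U U' hU hU')⟩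

theorem LE.refl (Γ : Env E) : LE Γ Γ := (EqT.refl Γ).le

theorem LE.trans {Γ₁ Γ₂ Γ₃ : Env E} (h : LE Γ₁ Γ₂) (h' : LE Γ₂ Γ₃) : LE Γ₁ Γ₃ := by
  refine ⟨fun p => (h.1 p).trans (h'.1 p), fun p U W hU hW => ?_⟩
  cases hV : Γ₂ p with
  | none => simp [(h.1 p).2 hV] at hU
  | some V => exact (h.2 p U V hU hV).trans (h'.2 p V W hV hW)

theorem LE.update {Γ Γ' : Env E} (h : LE Γ Γ') {U U' : Ty E} (hU : Ty.TSub U U') (p : Vr × ℕ) :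
    LE (update Γ p U) (update Γ' p U') := by
  refine ⟨fun q => ?_, fun q V V' => ?_⟩ <;> have h₁ := h.1 q <;> have h₂ := h.2 q <;>
    simp only [Env.update] <;> grind

theorem LE.erase {Γ Γ' : Env E} (h : LE Γ Γ') (p : Vr × ℕ) : LE (erase Γ p) (erase Γ' p) := by
  refine ⟨fun q => ?_, fun q V V' => ?_⟩ <;> have h₁ := h.1 q <;> have h₂ := h.2 q <;>
    simp only [Env.erase] <;> grind

theorem LE.inter {Γ₁ Γ₁' Γ₂ Γ₂' : Env E} (h : LE Γ₁ Γ₁') (h' : LE Γ₂ Γ₂') :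
    LE (inter Γ₁ Γ₂) (inter Γ₁' Γ₂') := by
  refine ⟨fun q => ?_, fun q V V' => ?_⟩ <;> have h₁ := h.1 q <;> have h₂ := h.2 q <;>
    have h₃ := h'.1 q <;> have h₄ := h'.2 q <;> simp only [Env.inter] <;>
    cases e₁ : Γ₁ q <;> cases e₂ : Γ₂ q <;> cases e₃ : Γ₁' q <;> cases e₄ : Γ₂' q <;> simp_all
  all_goals
    rintro rfl rfl
    first | assumption | exact .interCongr (by assumption) (by assumption)

theorem EqT.inter {Γ₁ Γ₁' Γ₂ Γ₂' : Env E} (h : EqT Γ₁ Γ₁') (h' : EqT Γ₂ Γ₂') :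
    EqT (inter Γ₁ Γ₂) (inter Γ₁' Γ₂') := by
  refine ⟨fun q => ?_, fun q V V' => ?_⟩ <;> have h₁ := h.1 q <;> have h₂ := h.2 q <;>
    have h₃ := h'.1 q <;> have h₄ := h'.2 q <;> simp only [Env.inter] <;>
    cases e₁ : Γ₁ q <;> cases e₂ : Γ₂ q <;> cases e₃ : Γ₁' q <;> cases e₄ : Γ₂' q <;> simp_all
  all_goals
    rintro rfl rfl
    first | assumption | exact .interCongr (by assumption) (by assumption)

theorem inter_comm (Γ₁ Γ₂ : Env E) : EqT (inter Γ₁ Γ₂) (inter Γ₂ Γ₁) := by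
  refine ⟨fun q => ?_, fun q V V' => ?_⟩ <;> simp only [inter] <;>
    cases Γ₁ q <;> cases Γ₂ q <;> simp <;> rintro rfl rfl <;>
    first | exact .comm _ _ | exact .refl _

theorem inter_assoc (Γ₁ Γ₂ Γ₃ : Env E) :
    EqT (inter (inter Γ₁ Γ₂) Γ₃) (inter Γ₁ (inter Γ₂ Γ₃)) := by
  refine ⟨fun q => ?_, fun q V V' => ?_⟩ <;> simp only [inter] <;>
    cases Γ₁ q <;> cases Γ₂ q <;> cases Γ₃ q <;> simp <;> rintro rfl rfl <;>
    first | exact .assoc _ _ _ | exact .refl _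

theorem inter_self (Γ : Env E) : EqT (inter Γ Γ) Γ := by
  refine ⟨fun q => ?_, fun q V V' => ?_⟩ <;> simp only [inter] <;>
    cases Γ q <;> simp
  rintro rfl rfl
  exact .idem _

theorem eexp_inter (e : E) (Γ₁ Γ₂ : Env E) :
    EqT (eexp e (inter Γ₁ Γ₂)) (inter (eexp e Γ₁) (eexp e Γ₂)) := by
  constructor
  · rintro ⟨x, _ | n⟩ <;> simp only [eexp, inter]
    cases Γ₁ (x, n) <;> cases Γ₂ (x, n) <;> simp
  · rintro ⟨x, _ | n⟩ V V' <;> simp only [eexp, inter]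
    · simp
    · cases Γ₁ (x, n) <;> cases Γ₂ (x, n) <;> simp <;> rintro rfl rfl <;>
        first | exact .dist _ _ _ | exact .refl _

theorem inter_right_comm (Γ₁ Γ₂ Γ₃ : Env E) :
    EqT (inter (inter Γ₁ Γ₂) Γ₃) (inter (inter Γ₁ Γ₃) Γ₂) :=
  (inter_assoc _ _ _).trans
    (((EqT.refl _).inter (inter_comm _ _)).trans (inter_assoc _ _ _).symm)

theorem inter_inter_distrib_right (Γ₁ Γ₂ Γ₃ : Env E) :
    EqT (inter (inter Γ₁ Γ₂) Γ₃) (inter (inter Γ₁ Γ₃) (inter Γ₂ Γ₃)) :=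
  (((EqT.refl _).inter (inter_self Γ₃).symm).trans (inter_assoc _ _ _).symm).trans
    (((inter_right_comm _ _ _).inter (.refl _)).trans (inter_assoc _ _ _))

theorem erase_inter (Γ₁ Γ₂ : Env E) (p : Vr × ℕ) :
    erase (inter Γ₁ Γ₂) p = inter (erase Γ₁ p) (erase Γ₂ p) := by
  funext q
  simp only [erase, inter]
  split <;> rfl

theorem erase_eexp (e : E) (Γ : Env E) (x : Vr) (n : ℕ) :
    erase (eexp e Γ) (x, n + 1) = eexp e (erase Γ (x, n)) := by
  funext ⟨y, m⟩
  cases m <;> simp [erase, eexp]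
  split <;> simp

theorem erase_of_eq_none {Γ : Env E} {p : Vr × ℕ} (h : Γ p = none) : erase Γ p = Γ := by
  funext q
  simp only [erase]
  split <;> simp_all

theorem erase_update {Γ : Env E} {p : Vr × ℕ} (h : Γ p = none) (U : Ty E) :
    erase (update Γ p U) p = Γ := by
  funext q
  simp only [erase, update]
  split <;> simp_all

theorem mem_dom_inter {Γ₁ Γ₂ : Env E} {p : Vr × ℕ} :
    p ∈ dom (inter Γ₁ Γ₂) ↔ p ∈ dom Γ₁ ∨ p ∈ dom Γ₂ := by
  simp only [dom, inter, Set.mem_ofPred_eq]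
  cases Γ₁ p <;> cases Γ₂ p <;> simp

theorem LE.mem_dom_iff {Γ Γ' : Env E} (h : LE Γ Γ') {p : Vr × ℕ} : p ∈ dom Γ ↔ p ∈ dom Γ' :=
  not_congr (h.1 p)

theorem mem_dom_eexp {e : E} {Γ : Env E} {x : Vr} {n : ℕ} :
    (x, n) ∈ dom (eexp e Γ) ↔ ∃ k, n = k + 1 ∧ (x, k) ∈ dom Γ := by
  cases n <;> simp [dom, eexp]

theorem mem_dom_erase {Γ : Env E} {p q : Vr × ℕ} : q ∈ dom (erase Γ p) ↔ q ≠ p ∧ q ∈ dom Γ := by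
  simp only [dom, erase, Set.mem_ofPred_eq]
  split <;> simp_all

theorem mem_dom_update {Γ : Env E} {p q : Vr × ℕ} {U : Ty E} :
    q ∈ dom (update Γ p U) ↔ q = p ∨ q ∈ dom Γ := by
  simp only [dom, update, Set.mem_ofPred_eq]
  split <;> simp_all

theorem mem_dom_single {p q : Vr × ℕ} {U : Ty E} : q ∈ dom (single p U) ↔ q = p := by
  simp [dom, single]

theorem good_and_deg_inter {Γ₁ Γ₂ : Env E} {p : Vr × ℕ} {k : ℕ}
    (h₁ : ∀ U, Γ₁ p = some U → Ty.GoodTy U ∧ Ty.deg U = k)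
    (h₂ : ∀ U, Γ₂ p = some U → Ty.GoodTy U ∧ Ty.deg U = k) (U : Ty E)
    (hU : inter Γ₁ Γ₂ p = some U) : Ty.GoodTy U ∧ Ty.deg U = k := by
  simp only [inter] at hU
  grind [Ty.goodTy_inter_iff, Ty.deg]

end Env

namespace Der2

variable {E : Type} {M N : Trm} {Γ Γ₁ Γ₂ : Env E} {U V : Ty E}

theorem dom_eq (h : Der2 M Γ U) : Env.dom Γ = Trm.FV M := by
  induction h with
  | ax => ext; simp [Env.mem_dom_single, Trm.FV]
  | @arrI Γ x n M _ _ _ _ hn _ ih =>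
    have hn : (x, n) ∉ Env.dom Γ := by simpa [Env.dom] using hn
    ext q
    simp only [Trm.FV, ← ih, Set.mem_sdiff, Env.mem_dom_update, Set.mem_singleton_iff]
    grind
  | arrE _ _ _ _ _ ih₁ ih₂ => ext; simp [Env.mem_dom_inter, Trm.FV, ih₁, ih₂]
  | inter _ _ ih₁ ih₂ => ext; simp [Env.mem_dom_inter, ih₁, ih₂]
  | exp e _ ih =>
    ext ⟨x, n⟩
    rw [Env.mem_dom_eexp, ih]
    cases n <;> simp [Trm.mem_FV_lift, Trm.not_mem_FV_lift_zero]
  | sub _ _ hle ih => ext; rw [hle.mem_dom_iff, ih]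

theorem eq_none_iff (h : Der2 M Γ U) (p : Vr × ℕ) : Γ p = none ↔ p ∉ Trm.FV M := by
  simp [← h.dom_eq, Env.dom]

theorem joinable_self (h : Der2 M Γ U) : Env.Joinable Γ Γ := by
  induction h with
  | ax => intro x m n; simp only [Env.mem_dom_single]; grind
  | arrI _ _ _ _ ih =>
    intro x m n hm hn
    exact ih x m n (Env.mem_dom_update.2 (.inr hm)) (Env.mem_dom_update.2 (.inr hn))
  | arrE _ _ _ _ hj ih₁ ih₂ =>
    intro x m n
    simp only [Env.mem_dom_inter]
    rintro (hm | hm) (hn | hn)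
    exacts [ih₁ x m n hm hn, hj x m n hm hn, (hj x n m hn hm).symm, ih₂ x m n hm hn]
  | inter h₁ h₂ ih₁ _ =>
    intro x m n
    simp only [Env.mem_dom_inter, h₂.dom_eq, ← h₁.dom_eq, or_self]
    exact ih₁ x m n
  | exp e _ ih =>
    intro x m n
    simp only [Env.mem_dom_eexp]
    rintro ⟨k, rfl, hk⟩ ⟨l, rfl, hl⟩
    rw [ih x k l hk hl]
  | sub _ _ hle ih =>
    intro x m n
    simp only [hle.mem_dom_iff]
    exact ih x m n

theorem good_and_deg (h : Der2 M Γ U) : Ty.GoodTy U ∧ Ty.deg U = Trm.deg M ∧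
    ∀ p V, Γ p = some V → Ty.GoodTy V ∧ Ty.deg V = p.2 := by
  induction h with
  | ax x hT hg =>
    refine ⟨hg, hT.deg_eq_zero, fun p V => ?_⟩
    simp only [Env.single]
    split
    · rintro ⟨⟩
      simp_all [hT.deg_eq_zero]
    · simp
  | @arrI Γ x n M U T hU hT hn h ih =>
    obtain ⟨hg, hd, hΓ⟩ := ih
    have h0 := hT.deg_eq_zero
    refine ⟨Ty.goodTy_arr_iff.2 ⟨(hΓ (x, n) U (by simp [Env.update])).1, hg, by simp [h0]⟩,
      by simp [Ty.deg, Trm.deg, ← hd, h0], fun p V hV => hΓ p V ?_⟩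
    simp only [Env.update]
    split <;> simp_all
  | @arrE Γ₁ Γ₂ M₁ M₂ U T hU hT _ _ _ ih₁ ih₂ =>
    have h0 := hT.deg_eq_zero
    have hd := ih₁.2.1
    refine ⟨(Ty.goodTy_arr_iff.1 ih₁.1).2.1, ?_, fun p V => ?_⟩
    · simp only [Ty.deg, Trm.deg] at hd ⊢
      omega
    · exact Env.good_and_deg_inter (ih₁.2.2 p) (ih₂.2.2 p) V
  | @inter Γ₁ Γ₂ M U₁ U₂ _ _ ih₁ ih₂ =>
    refine ⟨Ty.goodTy_inter_iff.2 ⟨ih₁.1, ih₂.1, ih₁.2.1.trans ih₂.2.1.symm⟩,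
      by simp [Ty.deg, ih₁.2.1, ih₂.2.1], fun p =>
        Env.good_and_deg_inter (ih₁.2.2 p) (ih₂.2.2 p)⟩
  | @exp e Γ M U _ ih =>
    refine ⟨.exp e ih.1, by simp [Ty.deg, Trm.deg_lift, ih.2.1], ?_⟩
    rintro ⟨x, _ | n⟩ V <;> simp only [Env.eexp, reduceCtorEq, false_imp_iff, Option.map_eq_some_iff]
    rintro ⟨W, hW, rfl⟩
    have := ih.2.2 _ _ hW
    exact ⟨.exp e this.1, by simp [Ty.deg, this.2]⟩
  | @sub Γ Γ' M U U' _ hs hle ih =>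
    have := hs.deg_eq_and_good_iff
    refine ⟨this.2.1 ih.1, this.1.symm.trans ih.2.1, fun p V hV => ?_⟩
    cases hW : Γ p with
    | none => simp [(hle.1 p).2 hW] at hV
    | some W =>
      have h₁ := (hle.2 p V W hV hW).deg_eq_and_good_iff
      have h₂ := ih.2.2 p W hW
      exact ⟨h₁.2.2 h₂.1, h₁.1.trans h₂.2⟩

theorem of_le (h : Der2 M Γ U) (hle : Env.LE Γ₁ Γ) : Der2 M Γ₁ U :=
  h.sub (.ofEq (.refl U)) hle

theorem of_sub (h : Der2 M Γ U) (hs : Ty.TSub U V) : Der2 M Γ V :=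
  h.sub hs (.refl Γ)

theorem inter_left (h : Der2 M Γ (.inter U V)) : Der2 M Γ U :=
  h.of_sub (.inter_left h.good_and_deg.1)

theorem inter_right (h : Der2 M Γ (.inter U V)) : Der2 M Γ V :=
  h.of_sub (.inter_right h.good_and_deg.1)

theorem inter_le_left (h₁ : Der2 M Γ₁ U) (h₂ : Der2 M Γ₂ V) : Env.LE (Env.inter Γ₁ Γ₂) Γ₁ := by
  refine ⟨fun p => ?_, fun p W W' => ?_⟩ <;>
    have e := (h₁.eq_none_iff p).trans (h₂.eq_none_iff p).symm <;>
    have g₁ := h₁.good_and_deg.2.2 p <;> have g₂ := h₂.good_and_deg.2.2 p <;>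
    simp only [Env.inter] <;> cases e₁ : Γ₁ p <;> cases e₂ : Γ₂ p <;> simp_all
  rintro rfl rfl
  exact .interElim g₂.1 (g₁.2.trans g₂.2.symm)

theorem inter_le_right (h₁ : Der2 M Γ₁ U) (h₂ : Der2 M Γ₂ V) : Env.LE (Env.inter Γ₁ Γ₂) Γ₂ :=
  (Env.inter_comm _ _).le.trans (h₂.inter_le_left h₁)

/-- Every conjunct of the given type at the head of which stands an arrow `A → B` comes
with a typing of the body of the abstraction `λx^n.M`. -/
def LamInv (x : Vr) (n : ℕ) (M : Trm) (Γ : Env E) : Ty E → Prop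
  | .arr A B => Der2 M (Env.update Γ (x, n) A) B
  | .inter V W => LamInv x n M Γ V ∧ LamInv x n M Γ W
  | _ => True

theorem LamInv.of_le {x : Vr} {n : ℕ} (hle : Env.LE Γ₁ Γ) (h : LamInv x n M Γ V) :
    LamInv x n M Γ₁ V := by
  induction V with
  | arr A B => exact Der2.of_le h (hle.update (.ofEq (.refl A)) _)
  | inter V W ihV ihW => exact ⟨ihV h.1, ihW h.2⟩
  | _ => trivial

theorem lamInv_congr {x : Vr} {n : ℕ} (h : Ty.TEq U V) :
    LamInv x n M Γ U ↔ LamInv x n M Γ V := by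
  induction h with
  | arrCongr hA hB =>
    exact ⟨fun h => h.sub (.ofEq hB) ((Env.LE.refl Γ).update (.ofEq hA.symm) _),
      fun h => h.sub (.ofEq hB.symm) ((Env.LE.refl Γ).update (.ofEq hA) _)⟩
  | _ => grind [LamInv]

theorem LamInv.of_sub {x : Vr} {n : ℕ} (hs : Ty.TSub U V) (h : LamInv x n M Γ U) :
    LamInv x n M Γ V := by
  induction hs with
  | ofEq hE => exact (lamInv_congr hE).1 h
  | trans _ _ ih₁ ih₂ => exact ih₂ (ih₁ h)
  | interElim => exact h.1
  | interCongr _ _ ih₁ ih₂ => exact ⟨ih₁ h.1, ih₂ h.2⟩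
  | arr hA hB => exact Der2.sub h hB ((Env.LE.refl Γ).update hA _)
  | expCongr => trivial

theorem lamInv {x : Vr} {n : ℕ} (h : Der2 (.lam x n M) Γ U) : LamInv x n M Γ U := by
  generalize hL : Trm.lam x n M = L at h
  induction h with
  | ax => cases hL
  | arrI _ _ _ h => cases hL; exact h
  | arrE => cases hL
  | inter h₁ h₂ ih₁ ih₂ =>
    exact ⟨(ih₁ hL).of_le (h₁.inter_le_left h₂), (ih₂ hL).of_le (h₁.inter_le_right h₂)⟩
  | exp => trivial
  | sub _ hs hle ih => exact ((ih hL).of_le hle).of_sub hs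

/-- Every conjunct `eW` of the given type comes with a typing of type `W` of a term whose
lift is `M`. -/
def ExpInv (M : Trm) (Γ : Env E) : Ty E → Prop
  | .exp e W => ∃ M' Γ', M = Trm.lift M' ∧ Env.LE Γ (Env.eexp e Γ') ∧ Der2 M' Γ' W
  | .inter V W => ExpInv M Γ V ∧ ExpInv M Γ W
  | _ => True

theorem ExpInv.of_le (hle : Env.LE Γ₁ Γ) (h : ExpInv M Γ V) : ExpInv M Γ₁ V := by
  induction V with
  | exp e W =>
    obtain ⟨M', Γ', rfl, hΓ, h'⟩ := h
    exact ⟨M', Γ', rfl, hle.trans hΓ, h'⟩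
  | inter V W ihV ihW => exact ⟨ihV h.1, ihW h.2⟩
  | _ => trivial

theorem ExpInv.exp_mono {e : E} (hs : ∀ M' (Γ' : Env E), Der2 M' Γ' U → Der2 M' Γ' V)
    (h : ExpInv M Γ (.exp e U)) : ExpInv M Γ (.exp e V) := by
  obtain ⟨M', Γ', rfl, hΓ, h'⟩ := h
  exact ⟨M', Γ', rfl, hΓ, hs _ _ h'⟩

theorem ExpInv.exp_inter {e : E} (hU : ExpInv M Γ (.exp e U)) (hV : ExpInv M Γ (.exp e V)) :
    ExpInv M Γ (.exp e (.inter U V)) := by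
  obtain ⟨M₁, Γ₁, rfl, hΓ₁, h₁⟩ := hU
  obtain ⟨M₂, Γ₂, hM, hΓ₂, h₂⟩ := hV
  obtain rfl := Trm.lift_injective hM
  exact ⟨M₁, _, rfl, (Env.inter_self Γ).symm.le.trans
    ((hΓ₁.inter hΓ₂).trans (Env.eexp_inter e Γ₁ Γ₂).symm.le), h₁.inter h₂⟩

theorem expInv_congr (h : Ty.TEq U V) : ExpInv M Γ U ↔ ExpInv M Γ V := by
  induction h with
  | expCongr e hE =>
    exact ⟨.exp_mono fun _ _ h => h.of_sub (.ofEq hE),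
      .exp_mono fun _ _ h => h.of_sub (.ofEq hE.symm)⟩
  | dist e U V =>
    exact ⟨fun h => ⟨h.exp_mono fun _ _ => inter_left, h.exp_mono fun _ _ => inter_right⟩,
      fun h => h.1.exp_inter h.2⟩
  | _ => grind [ExpInv]

theorem ExpInv.of_sub (hs : Ty.TSub U V) (h : ExpInv M Γ U) : ExpInv M Γ V := by
  induction hs with
  | ofEq hE => exact (expInv_congr hE).1 h
  | trans _ _ ih₁ ih₂ => exact ih₂ (ih₁ h)
  | interElim => exact h.1
  | interCongr _ _ ih₁ ih₂ => exact ⟨ih₁ h.1, ih₂ h.2⟩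
  | arr => trivial
  | expCongr e hs => exact h.exp_mono fun _ _ h => h.of_sub hs

theorem expInv (h : Der2 M Γ U) : ExpInv M Γ U := by
  induction h with
  | ax x hT => cases hT <;> trivial
  | arrI => trivial
  | arrE _ hT => cases hT <;> trivial
  | inter h₁ h₂ ih₁ ih₂ =>
    exact ⟨ih₁.of_le (h₁.inter_le_left h₂), ih₂.of_le (h₁.inter_le_right h₂)⟩
  | exp e h => exact ⟨_, _, rfl, .refl _, h⟩
  | sub _ hs hle ih => exact (ih.of_le hle).of_sub hs

theorem subst {x : Vr} {n : ℕ} (hM : Der2 M Γ₁ V) (hx : Γ₁ (x, n) = some U) (hN : Der2 N Γ₂ U)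
    (hj : Env.Joinable (Env.erase Γ₁ (x, n)) Γ₂)
    (hc : ∀ y m, (y, m) ∈ Trm.FV N → y ∉ Trm.BV M) :
    Der2 (Trm.subst x n N M) (Env.inter (Env.erase Γ₁ (x, n)) Γ₂) V := by
  induction hM generalizing n N Γ₂ U with
  | @ax y T hT hg =>
    simp only [Env.single, Option.ite_none_right_eq_some, Option.some.injEq] at hx
    obtain ⟨⟨⟩, rfl⟩ := hx
    have : Env.inter (Env.erase (Env.single (x, 0) T) (x, 0)) Γ₂ = Γ₂ := by
      funext q
      simp only [Env.inter, Env.erase, Env.single]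
      split <;> simp_all
    simpa [Trm.subst, this] using hN
  | @arrI Γ y m M A B hA hB hn h ih =>
    have hne : (x, n) ≠ (y, m) := by rintro ⟨⟩; simp [hn] at hx
    have hyN : ∀ k, (y, k) ∉ Trm.FV N := fun k hk => hc y k hk (by simp [Trm.BV])
    have hy₂ : Γ₂ (y, m) = none := (hN.eq_none_iff _).2 (hyN m)
    have key := ih (n := n) (by simpa [Env.update, hne] using hx) hN (by
      intro z k l hz hz₂
      simp only [Env.mem_dom_erase, Env.mem_dom_update] at hz
      obtain ⟨hz₁, hz | hz⟩ := hz
      · obtain ⟨rfl, rfl⟩ := Prod.mk.inj hz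
        rw [hN.dom_eq] at hz₂
        exact absurd hz₂ (hyN l)
      · exact hj z k l (Env.mem_dom_erase.2 ⟨hz₁, hz⟩) hz₂)
      (fun z k hz hb => hc z k hz (by simp [Trm.BV, hb]))
    have henv : Env.inter (Env.erase (Env.update Γ (y, m) A) (x, n)) Γ₂ =
        Env.update (Env.inter (Env.erase Γ (x, n)) Γ₂) (y, m) A := by
      funext q
      simp only [Env.inter, Env.erase, Env.update]
      grind
    rw [henv] at key
    have hs : ¬(y = x ∧ m = n) := by rintro ⟨rfl, rfl⟩; exact hne rfl
    simp only [Trm.subst, hs, if_false]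
    refine arrI hA hB ?_ key
    simp [Env.inter, Env.erase, hn, hy₂]
  | @arrE Δ₁ Δ₂ M₁ M₂ A B hA hB h₁ h₂ hj₁₂ ih₁ ih₂ =>
    have hself := hN.joinable_self
    have hc₁ : ∀ y m, (y, m) ∈ Trm.FV N → y ∉ Trm.BV M₁ :=
      fun y m hy hb => hc y m hy (.inl hb)
    have hc₂ : ∀ y m, (y, m) ∈ Trm.FV N → y ∉ Trm.BV M₂ :=
      fun y m hy hb => hc y m hy (.inr hb)
    rw [Env.erase_inter] at hj ⊢
    have hj₁ : Env.Joinable (Env.erase Δ₁ (x, n)) Γ₂ :=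
      fun y k l hk hl => hj y k l (Env.mem_dom_inter.2 (.inl hk)) hl
    have hj₂ : Env.Joinable (Env.erase Δ₂ (x, n)) Γ₂ :=
      fun y k l hk hl => hj y k l (Env.mem_dom_inter.2 (.inr hk)) hl
    have hj' : Env.Joinable (Env.erase Δ₁ (x, n)) (Env.erase Δ₂ (x, n)) :=
      fun y k l hk hl => hj₁₂ y k l (Env.mem_dom_erase.1 hk).2 (Env.mem_dom_erase.1 hl).2
    simp only [Trm.subst]
    cases hx₁ : Δ₁ (x, n) with
    | none =>
      cases hx₂ : Δ₂ (x, n) with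
      | none => simp [Env.inter, hx₁, hx₂] at hx
      | some U₂ =>
        simp only [Env.inter, hx₁, hx₂, Option.some.injEq] at hx
        subst hx
        rw [Trm.subst_eq_self ((h₁.eq_none_iff _).1 hx₁)]
        rw [Env.erase_of_eq_none hx₁] at hj₁ hj' ⊢
        refine (arrE hA hB h₁ (ih₂ hx₂ hN hj₂ hc₂) fun y k l hk hl => ?_).of_le
          (Env.inter_assoc _ _ _).le
        exact (Env.mem_dom_inter.1 hl).elim (hj' y k l hk) (hj₁ y k l hk)
    | some U₁ =>
      cases hx₂ : Δ₂ (x, n) with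
      | none =>
        simp only [Env.inter, hx₁, hx₂, Option.some.injEq] at hx
        subst hx
        rw [Trm.subst_eq_self ((h₂.eq_none_iff _).1 hx₂)]
        rw [Env.erase_of_eq_none hx₂] at hj₂ hj' ⊢
        refine (arrE hA hB (ih₁ hx₁ hN hj₁ hc₁) h₂ fun y k l hk hl => ?_).of_le
          (Env.inter_right_comm _ _ _).le
        exact (Env.mem_dom_inter.1 hk).elim (hj' y k l · hl) (fun hk => (hj₂ y l k hl hk).symm)
      | some U₂ =>
        simp only [Env.inter, hx₁, hx₂, Option.some.injEq] at hx
        subst hx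
        refine (arrE hA hB (ih₁ hx₁ hN.inter_left hj₁ hc₁) (ih₂ hx₂ hN.inter_right hj₂ hc₂)
          fun y k l hk hl => ?_).of_le (Env.inter_inter_distrib_right _ _ _).le
        rcases Env.mem_dom_inter.1 hk with hk | hk <;> rcases Env.mem_dom_inter.1 hl with hl | hl
        exacts [hj' y k l hk hl, hj₁ y k l hk hl, (hj₂ y l k hl hk).symm, hself y k l hk hl]
  | @inter Δ₁ Δ₂ M V₁ V₂ h₁ h₂ ih₁ ih₂ =>
    rw [Env.erase_inter] at hj ⊢
    have hj₁ : Env.Joinable (Env.erase Δ₁ (x, n)) Γ₂ :=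
      fun y k l hk hl => hj y k l (Env.mem_dom_inter.2 (.inl hk)) hl
    have hj₂ : Env.Joinable (Env.erase Δ₂ (x, n)) Γ₂ :=
      fun y k l hk hl => hj y k l (Env.mem_dom_inter.2 (.inr hk)) hl
    have hnone := (h₁.eq_none_iff (x, n)).trans (h₂.eq_none_iff (x, n)).symm
    cases hx₁ : Δ₁ (x, n) with
    | none => simp [Env.inter, hx₁, hnone.1 hx₁] at hx
    | some U₁ =>
      cases hx₂ : Δ₂ (x, n) with
      | none => simp [hnone.2 hx₂] at hx₁
      | some U₂ =>
        simp only [Env.inter, hx₁, hx₂, Option.some.injEq] at hx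
        subst hx
        exact ((ih₁ hx₁ hN.inter_left hj₁ hc).inter (ih₂ hx₂ hN.inter_right hj₂ hc)).of_le
          (Env.inter_inter_distrib_right _ _ _).le
  | @exp e Γ M V h ih =>
    cases n with
    | zero => simp [Env.eexp] at hx
    | succ n =>
      simp only [Env.eexp, Option.map_eq_some_iff] at hx
      obtain ⟨W, hW, rfl⟩ := hx
      obtain ⟨N', Γ', rfl, hle, hN'⟩ := hN.expInv
      rw [Trm.subst_lift, Env.erase_eexp]
      rw [Env.erase_eexp] at hj
      refine (exp e (ih hW hN' ?_ ?_)).of_le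
        (((Env.LE.refl _).inter hle).trans (Env.eexp_inter e _ _).symm.le)
      · intro y k l hk hl
        exact Nat.succ_injective (hj y (k + 1) (l + 1) (Env.mem_dom_eexp.2 ⟨k, rfl, hk⟩)
          (hle.mem_dom_iff.2 (Env.mem_dom_eexp.2 ⟨l, rfl, hl⟩)))
      · intro y m hy
        rw [← Trm.BV_lift]
        exact hc y (m + 1) (Trm.mem_FV_lift.2 hy)
  | @sub Δ Δ' M V V' h hs hle ih =>
    cases hW : Δ (x, n) with
    | none => simp [(hle.1 _).2 hW] at hx
    | some W =>
      refine (ih hW (hN.of_sub (hle.2 _ _ _ hx hW)) ?_ hc).sub hs ((hle.erase _).inter (.refl _))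
      intro y k l hk hl
      exact hj y k l ((hle.erase _).mem_dom_iff.2 hk) hl

theorem of_beta (h : Der2 M Γ U) (r : Trm.Beta M N) : Der2 N Γ U := by
  induction h generalizing N with
  | ax => cases r
  | arrI hU hT hn _ ih =>
    cases r with
    | lam r => exact arrI hU hT hn (ih r)
  | @arrE Γ₁ Γ₂ _ _ A _ hU hT h₁ h₂ hj ih₁ ih₂ =>
    cases r with
    | @redex x n P _ _ _ hc =>
      have hn : Γ₁ (x, n) = none := (h₁.eq_none_iff _).2 (by simp [Trm.FV])
      have he := Env.erase_update hn A
      simpa only [he] using Der2.subst (x := x) (n := n) h₁.lamInv (by simp [Env.update]) h₂ (by rwa [he]) hc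
    | appL r => exact arrE hU hT (ih₁ r) h₂ hj
    | appR r => exact arrE hU hT h₁ (ih₂ r) hj
  | inter _ _ ih₁ ih₂ => exact (ih₁ r).inter (ih₂ r)
  | exp e _ ih =>
    obtain ⟨N', rfl, r'⟩ := r.of_lift
    exact exp e (ih r')
  | sub _ hs hle ih => exact (ih r).sub hs hle

end Der2

/-- subject reduction for β in ⊢2: if `M : ⟨Γ ⊢2 U⟩` is derivable
and `M ▷β* N`, then `N : ⟨Γ ⊢2 U⟩` is derivable. -/
theorem subject_reduction_der2 {E : Type} (M N : Trm) (Γ : Env E) (U : Ty E)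
    (h : Der2 M Γ U) (r : Trm.Betas M N) : Der2 N Γ U := by
  induction r with
  | refl => exact h
  | tail _ r ih => exact ih.of_beta r
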